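/- arXiv:2010.01221 — 2 statements merged into one kernel-verified Lean document; each statement's English description precedes it below -/
import Mathlib

section
/- Let p : ℝⁿ → [1,∞) be a measurable exponent function with p⁺ := ess sup p < ∞. Let Q be a cube in ℝⁿ, {Q_j}_{j∈ℕ} a countable pairwise-disjoint family of subcubes of Q with Σ_j |Q_j| > 0, and {h_j}_{j∈ℕ} nonnegative measurable functions satisfying (1/|Q_j|) ∫_{Q_j} h_j(x)^{p(x)} dx ≤ 1 for every j. Then ‖Σ_{j∈ℕ} h_j χ_{Q_j}‖_{L^{p(·)}(Q, dx/|Q|)} ≤ (Σ_{j∈ℕ} |Q_j| / |Q|)^{1/p⁺}. -/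
open MeasureTheory Set Filter
open scoped ENNReal

noncomputable section

/-- An axis-parallel cube in `ℝⁿ`, given by its lower corner and (positive) sidelength. -/
structure Cube (n : ℕ) where
  corner : Fin n → ℝ
  side : ℝ
  side_pos : 0 < side

/-- The set of points of a cube. -/
def Cube.carrier {n : ℕ} (Q : Cube n) : Set (Fin n → ℝ) :=
  {x | ∀ i, Q.corner i ≤ x i ∧ x i ≤ Q.corner i + Q.side}

/-- A Borel measure on `ℝⁿ` is doubling with doubling constant `c ≥ 1` and doubling
dimension `d > 0`: every cube has finite positive measure and
`μ(Q̃) ≤ c (ℓ(Q̃)/ℓ(Q))^d μ(Q)` whenever `Q ⊆ Q̃`. -/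
def IsDoubling {n : ℕ} (μ : Measure (Fin n → ℝ)) (c d : ℝ) : Prop :=
  1 ≤ c ∧ 0 < d ∧ (∀ Q : Cube n, 0 < μ Q.carrier ∧ μ Q.carrier < ⊤) ∧
    ∀ Q Q' : Cube n, Q.carrier ⊆ Q'.carrier →
      μ Q'.carrier ≤ ENNReal.ofReal (c * (Q'.side / Q.side) ^ d) * μ Q.carrier

/-- `f_{Q,μ}`, the `μ`-average of `f` over the cube `Q`. -/
def cubeAvg {n : ℕ} (μ : Measure (Fin n → ℝ)) (Q : Cube n) (f : (Fin n → ℝ) → ℝ) : ℝ :=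
  ⨍ x in Q.carrier, f x ∂μ

/-- The mean oscillation of `f` over the cube `Q`. -/
def osc {n : ℕ} (μ : Measure (Fin n → ℝ)) (Q : Cube n) (f : (Fin n → ℝ) → ℝ) : ℝ :=
  ⨍ x in Q.carrier, |f x - cubeAvg μ Q f| ∂μ

/-- The `BMO(dμ)` norm: supremum of the mean oscillations over all cubes. -/
def bmoNorm {n : ℕ} (μ : Measure (Fin n → ℝ)) (f : (Fin n → ℝ) → ℝ) : ℝ :=
  ⨆ Q : Cube n, osc μ Q f

/-- Membership in `BMO(dμ)`: local integrability together with a finite supremum of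
mean oscillations. -/
def MemBMO {n : ℕ} (μ : Measure (Fin n → ℝ)) (f : (Fin n → ℝ) → ℝ) : Prop :=
  LocallyIntegrable f μ ∧ BddAbove (Set.range fun Q : Cube n => osc μ Q f)

/-- The local Luxemburg norm `‖f‖_{φ(L)(Q, dν/ν(Q))}`. -/
def luxNorm {n : ℕ} (φ : ℝ → ℝ) (ν : Measure (Fin n → ℝ)) (Q : Cube n)
    (f : (Fin n → ℝ) → ℝ) : ℝ :=
  sInf {l : ℝ | 0 < l ∧
    ∫⁻ x in Q.carrier, ENNReal.ofReal (φ (|f x| / l)) ∂ν ≤ ν Q.carrier}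

/-- The local variable-exponent Luxemburg norm `‖f‖_{L^{p(·)}(Q, dx/|Q|)}`. -/
def vpLuxNorm {n : ℕ} (p : (Fin n → ℝ) → ℝ) (Q : Cube n) (f : (Fin n → ℝ) → ℝ) : ℝ :=
  sInf {l : ℝ | 0 < l ∧
    ∫⁻ x in Q.carrier, ENNReal.ofReal ((|f x| / l) ^ p x) ≤ volume Q.carrier}

theorem Cube.carrier_eq_Icc {n : ℕ} (Q : Cube n) :
    Q.carrier = Icc Q.corner (fun i => Q.corner i + Q.side) := by
  ext x
  simp only [Cube.carrier, mem_ofPred_eq, mem_Icc, Pi.le_def, forall_and]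

theorem Cube.measurableSet_carrier {n : ℕ} (Q : Cube n) : MeasurableSet Q.carrier := by
  rw [Q.carrier_eq_Icc]
  exact measurableSet_Icc

theorem Cube.volume_carrier_ne_top {n : ℕ} (Q : Cube n) : volume Q.carrier ≠ ⊤ := by
  rw [Q.carrier_eq_Icc]
  exact isCompact_Icc.measure_lt_top.ne

/-- Pointwise, the modular of a sum over disjoint sets is the sum of the modulars. -/
theorem ofReal_tsum_indicator_rpow {α ι : Type*} {s : ι → Set α}
    (hs : Pairwise fun i j => Disjoint (s i) (s j)) (h : ι → α → ℝ) (x : α) {q : ℝ}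
    (hq : q ≠ 0) :
    ENNReal.ofReal ((∑' i, (s i).indicator (h i) x) ^ q) =
      ∑' i, (s i).indicator (fun y => ENNReal.ofReal (h i y ^ q)) x := by
  by_cases hx : ∃ i, x ∈ s i
  · obtain ⟨i, hi⟩ := hx
    have hni : ∀ j, j ≠ i → x ∉ s j := fun j hj hxj => (hs hj).ne_of_mem hxj hi rfl
    rw [tsum_eq_single i fun j hj => indicator_of_notMem (hni j hj) _,
      tsum_eq_single i fun j hj => indicator_of_notMem (hni j hj) _,
      indicator_of_mem hi, indicator_of_mem hi]
  · push Not at hx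
    simp [indicator_of_notMem (hx _), Real.zero_rpow hq]

/-- For `0 < c ≤ 1` and `q ≤ r`, dividing by `c ^ (1 / r)` costs at most a factor `c⁻¹`
in the `q`-th power. -/
theorem div_rpow_one_div_rpow_le {a c q r : ℝ} (ha : 0 ≤ a) (hc : 0 < c) (hc1 : c ≤ 1)
    (hr : 0 < r) (hqr : q ≤ r) : (a / c ^ (1 / r)) ^ q ≤ c⁻¹ * a ^ q := by
  rw [Real.div_rpow ha (Real.rpow_nonneg hc.le _), ← Real.rpow_mul hc.le, div_eq_inv_mul]
  have hle : c ≤ c ^ (1 / r * q) := by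
    refine Real.self_le_rpow_of_le_one hc.le hc1 ?_
    rw [one_div_mul_eq_div]
    exact (div_le_one hr).2 hqr
  gcongr

/-- The `A_∞` type estimate for the Lebesgue measure functional in the variable
Lebesgue scale: if `{Q_j}` is a countable pairwise-disjoint family of subcubes of `Q`
and each `h_j ≥ 0` satisfies `(1/|Q_j|) ∫_{Q_j} h_j^{p(x)} dx ≤ 1`, then
`‖Σ_j h_j χ_{Q_j}‖_{L^{p(·)}(Q, dx/|Q|)} ≤ (Σ_j |Q_j|/|Q|)^{1/p⁺}`. -/
theorem statement13 {n : ℕ} (p : (Fin n → ℝ) → ℝ) (hmeas : Measurable p)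
    (h1 : ∀ x, 1 ≤ p x) (pplus : ℝ)
    (hb : ∀ᵐ x ∂(volume : Measure (Fin n → ℝ)), p x ≤ pplus)
    (Q : Cube n) (J : Set ℕ) (Qj : ℕ → Cube n)
    (hsub : ∀ j ∈ J, (Qj j).carrier ⊆ Q.carrier)
    (hdisj : J.Pairwise fun i j => Disjoint (Qj i).carrier (Qj j).carrier)
    (hpos : 0 < ∑' j : J, (volume (Qj (j : ℕ)).carrier).toReal)
    (h : ℕ → (Fin n → ℝ) → ℝ)
    (hh : ∀ j ∈ J, (∀ x, 0 ≤ h j x) ∧ Measurable (h j) ∧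
      ∫⁻ x in (Qj j).carrier, ENNReal.ofReal (h j x ^ p x) ≤ volume (Qj j).carrier) :
    vpLuxNorm p Q (fun x => ∑' j : J, Set.indicator (Qj (j : ℕ)).carrier (h (j : ℕ)) x) ≤
      ((∑' j : J, (volume (Qj (j : ℕ)).carrier).toReal) / (volume Q.carrier).toReal) ^
        (1 / pplus) := by
  have hpw : Pairwise fun i j : J => Disjoint (Qj i).carrier (Qj j).carrier :=
    fun i j hij => hdisj i.2 j.2 (Subtype.coe_injective.ne hij)
  have hle : ∑' j : J, volume (Qj j).carrier ≤ volume Q.carrier := by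
    rw [← measure_iUnion hpw fun j => (Qj j).measurableSet_carrier]
    exact measure_mono (iUnion_subset fun j => hsub j j.2)
  have hSum : (∑' j : J, (volume (Qj j).carrier).toReal) =
      (∑' j : J, volume (Qj j).carrier).toReal :=
    (ENNReal.tsum_toReal_eq fun j : J => (Qj j).volume_carrier_ne_top).symm
  rw [hSum] at hpos ⊢
  set S := ∑' j : J, volume (Qj j).carrier
  have hSle : S.toReal ≤ (volume Q.carrier).toReal :=
    ENNReal.toReal_mono Q.volume_carrier_ne_top hle
  have hQ : 0 < (volume Q.carrier).toReal := hpos.trans_le hSle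
  set c := S.toReal / (volume Q.carrier).toReal with hcdef
  have hc : 0 < c := div_pos hpos hQ
  have hc1 : c ≤ 1 := (div_le_one hQ).2 hSle
  have hr : 0 < pplus := by
    obtain ⟨x, hx⟩ := hb.exists
    linarith [h1 x]
  refine csInf_le ⟨0, fun l hl => hl.1.le⟩ ⟨Real.rpow_pos_of_pos hc _, ?_⟩
  have hpt : ∀ᵐ x ∂(volume : Measure (Fin n → ℝ)),
      ENNReal.ofReal ((|∑' j : J, (Qj j).carrier.indicator (h j) x| / c ^ (1 / pplus)) ^ p x) ≤
        ENNReal.ofReal c⁻¹ *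
          ∑' j : J, (Qj j).carrier.indicator (fun y => ENNReal.ofReal (h j y ^ p y)) x := by
    filter_upwards [hb] with x hx
    have hf : 0 ≤ ∑' j : J, (Qj j).carrier.indicator (h j) x :=
      tsum_nonneg fun j => indicator_nonneg (fun y _ => (hh j j.2).1 y) x
    have hq : p x ≠ 0 := by linarith [h1 x]
    have key := ofReal_tsum_indicator_rpow hpw (fun j : J => h j) x hq
    have hind : ∀ j : J, (Qj j).carrier.indicator (fun y => ENNReal.ofReal (h j y ^ p y)) x =
        (Qj j).carrier.indicator (fun y => ENNReal.ofReal (h j y ^ p x)) x :=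
      fun j => by by_cases hj : x ∈ (Qj j).carrier <;> simp [hj]
    rw [abs_of_nonneg hf, tsum_congr hind, ← key, ← ENNReal.ofReal_mul (inv_nonneg.2 hc.le)]
    exact ENNReal.ofReal_le_ofReal (div_rpow_one_div_rpow_le hf hc hc1 hr hx)
  calc
    _ ≤ ∫⁻ x, ENNReal.ofReal c⁻¹ *
          ∑' j : J, (Qj j).carrier.indicator (fun y => ENNReal.ofReal (h j y ^ p y)) x :=
      (setLIntegral_le_lintegral _ _).trans (lintegral_mono_ae hpt)
    _ = ENNReal.ofReal c⁻¹ *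
          ∑' j : J, ∫⁻ x in (Qj j).carrier, ENNReal.ofReal (h j x ^ p x) := by
      rw [lintegral_const_mul' _ _ ENNReal.ofReal_ne_top, lintegral_tsum fun j : J =>
        (((hh j j.2).2.1.pow hmeas).ennreal_ofReal.indicator
          (Qj j).measurableSet_carrier).aemeasurable]
      simp_rw [lintegral_indicator (Cube.measurableSet_carrier _)]
    _ ≤ ENNReal.ofReal c⁻¹ * S := by
      exact mul_le_mul_right (ENNReal.tsum_le_tsum fun j : J => (hh j j.2).2.2) _
    _ = volume Q.carrier := by
      rw [← ENNReal.ofReal_toReal (ne_top_of_le_ne_top Q.volume_carrier_ne_top hle),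
        ← ENNReal.ofReal_mul (inv_nonneg.2 hc.le), hcdef, inv_div,
        div_mul_cancel₀ _ hpos.ne', ENNReal.ofReal_toReal Q.volume_carrier_ne_top]

end
end

section
/- Let μ be a doubling measure on ℝⁿ, let f ∈ L¹_loc(ℝⁿ, dμ) and let Q₀ be a cube in ℝⁿ. Then there exist a countable family 𝒮 of subcubes of Q₀, a family {E_Q}_{Q ∈ 𝒮} of pairwise disjoint measurable sets with E_Q ⊆ Q and μ(Q) ≤ 2 μ(E_Q) for every Q ∈ 𝒮, and a constant C > 0 depending only on c_μ and n_μ, such that for μ-almost every x ∈ Q₀: |f(x) − f_{Q₀,μ}| ≤ C Σ_{Q ∈ 𝒮} ((1/μ(Q)) ∫_Q |f − f_{Q,μ}| dμ) χ_Q(x). -/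
open MeasureTheory Set Filter
open scoped ENNReal

noncomputable section

namespace Cube

variable {n : ℕ}

lemma carrier_eq_Icc_s19 (Q : Cube n) :
    Q.carrier = Icc Q.corner (fun i => Q.corner i + Q.side) := by
  ext x
  simp only [carrier, mem_ofPred_eq, mem_Icc, Pi.le_def]
  exact forall_and

lemma carrier_eq_closedBall (Q : Cube n) :
    Q.carrier = Metric.closedBall (fun i => Q.corner i + Q.side / 2) (Q.side / 2) := by
  have := Q.side_pos
  ext x
  rw [mem_closedBall_iff_norm, pi_norm_le_iff_of_nonneg (by positivity)]
  simp only [carrier, mem_ofPred_eq, Pi.sub_apply, Real.norm_eq_abs, abs_le]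
  refine forall_congr' fun i => ?_
  constructor <;> rintro ⟨h₁, h₂⟩ <;> constructor <;> linarith

lemma isCompact_carrier (Q : Cube n) : IsCompact Q.carrier :=
  Q.carrier_eq_Icc_s19 ▸ isCompact_Icc

lemma measurableSet_carrier_s19 (Q : Cube n) : MeasurableSet Q.carrier :=
  Q.isCompact_carrier.measurableSet

/-- The dyadic descendant of `Q` of generation `k` with integer coordinates `z`. -/
def dyadic (Q : Cube n) (k : ℕ) (z : Fin n → ℤ) : Cube n where
  corner i := Q.corner i + z i * (Q.side / 2 ^ k)
  side := Q.side / 2 ^ k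
  side_pos := div_pos Q.side_pos (by positivity)

/-- The integer coordinates of the half-open dyadic cube of generation `k` containing `x`. -/
def index (Q : Cube n) (k : ℕ) (x : Fin n → ℝ) : Fin n → ℤ :=
  fun i => ⌊(x i - Q.corner i) / (Q.side / 2 ^ k)⌋

/-- The dyadic cube of generation `k` containing `x`. -/
def dyadicAt (Q : Cube n) (k : ℕ) (x : Fin n → ℝ) : Cube n :=
  Q.dyadic k (Q.index k x)

lemma dyadicAt_side (Q : Cube n) (k : ℕ) (x : Fin n → ℝ) :
    (Q.dyadicAt k x).side = Q.side / 2 ^ k := rfl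

lemma dyadicAt_congr {Q : Cube n} {k : ℕ} {x y : Fin n → ℝ} (h : Q.index k x = Q.index k y) :
    Q.dyadicAt k x = Q.dyadicAt k y := by
  rw [dyadicAt, h, dyadicAt]

lemma generation_eq_of_dyadic_eq {Q : Cube n} {k l : ℕ} {z w : Fin n → ℤ}
    (h : Q.dyadic k z = Q.dyadic l w) : k = l := by
  have h' : Q.side / 2 ^ k = Q.side / 2 ^ l := congrArg Cube.side h
  have hQ := Q.side_pos
  rw [div_eq_div_iff (by positivity) (by positivity)] at h'
  exact (pow_right_injective₀ (a := (2 : ℝ)) (by norm_num) (by norm_num)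
    (mul_left_cancel₀ hQ.ne' h')).symm

lemma index_eq_of_dyadicAt_eq {Q : Cube n} {k : ℕ} {x y : Fin n → ℝ}
    (h : Q.dyadicAt k x = Q.dyadicAt k y) : Q.index k x = Q.index k y := by
  have hQ : 0 < Q.side / 2 ^ k := (Q.dyadicAt k x).side_pos
  funext i
  have h' : Q.corner i + Q.index k x i * (Q.side / 2 ^ k) =
      Q.corner i + Q.index k y i * (Q.side / 2 ^ k) := congrFun (congrArg Cube.corner h) i
  exact_mod_cast mul_right_cancel₀ hQ.ne' (add_left_cancel h')

lemma measurable_index (Q : Cube n) (k : ℕ) : Measurable (Q.index k) := by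
  refine measurable_pi_lambda _ fun i => ?_
  exact (((measurable_pi_apply i).sub_const _).div_const _).floor

lemma index_eq_index_succ_div_two (Q : Cube n) (k : ℕ) (x : Fin n → ℝ) (i : Fin n) :
    Q.index k x i = Q.index (k + 1) x i / 2 := by
  have hQ := Q.side_pos
  have : (x i - Q.corner i) / (Q.side / 2 ^ k) =
      (x i - Q.corner i) / (Q.side / 2 ^ (k + 1)) / (2 : ℕ) := by
    rw [pow_succ]
    push_cast
    field_simp
  simp only [index]
  rw [this, Int.floor_div_natCast]
  rfl

lemma index_eq_of_index_succ_eq {Q : Cube n} {k : ℕ} {x y : Fin n → ℝ}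
    (h : Q.index (k + 1) x = Q.index (k + 1) y) : Q.index k x = Q.index k y := by
  funext i
  rw [Q.index_eq_index_succ_div_two k x, Q.index_eq_index_succ_div_two k y, h]

lemma index_eq_of_le {Q : Cube n} {k m : ℕ} {x y : Fin n → ℝ} (hkm : k ≤ m)
    (h : Q.index m x = Q.index m y) : Q.index k x = Q.index k y := by
  induction m, hkm using Nat.le_induction with
  | base => exact h
  | succ m _ ih => exact ih (index_eq_of_index_succ_eq h)

lemma mem_dyadicAt (Q : Cube n) (k : ℕ) (x : Fin n → ℝ) : x ∈ (Q.dyadicAt k x).carrier := by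
  intro i
  have hs : 0 < Q.side / 2 ^ k := (Q.dyadicAt k x).side_pos
  have h₁ := (le_div_iff₀ hs).1 (Int.floor_le ((x i - Q.corner i) / (Q.side / 2 ^ k)))
  have h₂ := (div_lt_iff₀ hs).1 (Int.lt_floor_add_one ((x i - Q.corner i) / (Q.side / 2 ^ k)))
  simp only [dyadicAt, dyadic, index]
  constructor <;> linarith

lemma index_eq_of_mem_dyadic {Q : Cube n} {k : ℕ} {z : Fin n → ℤ} {y : Fin n → ℝ}
    (hy : y ∈ (Q.dyadic k z).carrier)
    (hne : ∀ i, y i ≠ (Q.dyadic k z).corner i + (Q.dyadic k z).side) : Q.index k y = z := by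
  funext i
  have hs : 0 < Q.side / 2 ^ k := (Q.dyadic k z).side_pos
  have h₁ := (hy i).1
  have h₂ := lt_of_le_of_ne (hy i).2 (hne i)
  simp only [dyadic] at h₁ h₂
  rw [index, Int.floor_eq_iff, le_div_iff₀ hs, div_lt_iff₀ hs]
  constructor <;> linarith

lemma dyadic_zero_zero (Q : Cube n) : Q.dyadic 0 0 = Q := by
  cases Q
  simp [dyadic]

lemma dyadicAt_zero {Q : Cube n} {x : Fin n → ℝ} (hx : Q.index 0 x = 0) :
    Q.dyadicAt 0 x = Q := by
  rw [dyadicAt, hx, dyadic_zero_zero]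

lemma dyadicAt_succ_subset (Q : Cube n) (k : ℕ) (x : Fin n → ℝ) :
    (Q.dyadicAt (k + 1) x).carrier ⊆ (Q.dyadicAt k x).carrier := by
  intro y hy i
  obtain ⟨h₁, h₂⟩ := hy i
  have hs : 0 < Q.side / 2 ^ (k + 1) := (Q.dyadicAt (k + 1) x).side_pos
  have hk : Q.side / 2 ^ k = 2 * (Q.side / 2 ^ (k + 1)) := by
    rw [pow_succ]
    field_simp
  have hi := Q.index_eq_index_succ_div_two k x i
  have h₃ : 2 * Q.index k x i ≤ Q.index (k + 1) x i := by omega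
  have h₄ : Q.index (k + 1) x i ≤ 2 * Q.index k x i + 1 := by omega
  have h₃' : 2 * (Q.index k x i : ℝ) ≤ Q.index (k + 1) x i := by exact_mod_cast h₃
  have h₄' : (Q.index (k + 1) x i : ℝ) ≤ 2 * Q.index k x i + 1 := by exact_mod_cast h₄
  simp only [dyadicAt, dyadic] at h₁ h₂ ⊢
  rw [hk]
  constructor <;> nlinarith

lemma dyadicAt_subset (Q : Cube n) {k l : ℕ} (h : k ≤ l) (x : Fin n → ℝ) :
    (Q.dyadicAt l x).carrier ⊆ (Q.dyadicAt k x).carrier :=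
  antitone_nat_of_succ_le (f := fun k => (Q.dyadicAt k x).carrier)
    (fun k => Q.dyadicAt_succ_subset k x) h

lemma exists_cube_eq_closedBall (x : Fin n → ℝ) {r : ℝ} (hr : 0 < r) :
    ∃ Q : Cube n, Q.side = 2 * r ∧ Q.carrier = Metric.closedBall x r := by
  refine ⟨⟨fun i => x i - r, 2 * r, by positivity⟩, rfl, ?_⟩
  rw [carrier_eq_closedBall]
  congr 1
  · ext i
    simp
  · simp

end Cube

namespace IsDoubling

variable {n : ℕ} {μ : Measure (Fin n → ℝ)} {c d : ℝ}

lemma isLocallyFiniteMeasure (h : IsDoubling μ c d) : IsLocallyFiniteMeasure μ := by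
  refine ⟨fun x => ⟨Metric.closedBall x 1, Metric.closedBall_mem_nhds x one_pos, ?_⟩⟩
  obtain ⟨Q, -, hQ⟩ := Cube.exists_cube_eq_closedBall x one_pos
  exact hQ ▸ (h.2.2.1 Q).2

lemma isUnifLocDoublingMeasure (h : IsDoubling μ c d) : IsUnifLocDoublingMeasure μ := by
  refine ⟨(c * 2 ^ d).toNNReal, ?_⟩
  filter_upwards [self_mem_nhdsWithin] with r (hr : 0 < r) x
  obtain ⟨Q, hs, hQ⟩ := Cube.exists_cube_eq_closedBall x hr
  obtain ⟨Q', hs', hQ'⟩ := Cube.exists_cube_eq_closedBall x (mul_pos two_pos hr)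
  have := h.2.2.2 Q Q' (by rw [hQ, hQ']; exact Metric.closedBall_subset_closedBall (by linarith))
  rwa [hs, hs', hQ, hQ', mul_div_mul_left _ _ two_ne_zero, mul_div_assoc, div_self hr.ne',
    mul_one] at this

/-- Doubling measures do not charge coordinate hyperplanes. -/
lemma measure_hyperplane (h : IsDoubling μ c d) (i : Fin n) (a : ℝ) :
    μ {x | x i = a} = 0 := by
  have := h.isLocallyFiniteMeasure
  have := h.isUnifLocDoublingMeasure
  have hm : MeasurableSet {x : Fin n → ℝ | x i = a} :=
    measurableSet_eq_fun (measurable_pi_apply i) measurable_const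
  have key := IsUnifLocDoublingMeasure.ae_tendsto_measure_inter_div μ {x : Fin n → ℝ | x i = a} 2
  rw [← Measure.restrict_eq_zero, ← ae_eq_bot, ← empty_mem_iff_bot]
  filter_upwards [key, ae_restrict_mem hm] with x hx (hxa : x i = a)
  have hlim := hx (l := nhdsWithin (0 : ℝ) (Ioi 0)) (fun r j => x j + 2 * r) id tendsto_id (by
    filter_upwards [self_mem_nhdsWithin] with r (hr : 0 < r)
    rw [mem_closedBall_iff_norm, pi_norm_le_iff_of_nonneg (by simpa using hr.le)]
    intro j
    simp [abs_of_pos hr])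
  refine zero_ne_one (tendsto_nhds_unique (tendsto_const_nhds.congr' ?_) hlim)
  filter_upwards [self_mem_nhdsWithin] with r (hr : 0 < r)
  have : {x : Fin n → ℝ | x i = a} ∩ Metric.closedBall (fun j => x j + 2 * r) (id r) = ∅ := by
    refine eq_empty_of_forall_notMem fun y hy => ?_
    have h₁ : y i = a := hy.1
    have h₂ := (norm_le_pi_norm _ i).trans (mem_closedBall_iff_norm.1 hy.2)
    simp only [Pi.sub_apply, h₁, hxa, Real.norm_eq_abs, id, abs_le] at h₂
    linarith
  simp only [this, measure_empty, ENNReal.zero_div]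

/-- A closed dyadic cube agrees almost everywhere with its half-open version. -/
lemma index_preimage_ae_eq (h : IsDoubling μ c d) (Q : Cube n) (k : ℕ) (x : Fin n → ℝ) :
    (Q.index k ⁻¹' {Q.index k x} : Set (Fin n → ℝ)) =ᵐ[μ] (Q.dyadicAt k x).carrier := by
  have hne : ∀ᵐ y ∂μ, ∀ i, y i ≠ (Q.dyadicAt k x).corner i + (Q.dyadicAt k x).side :=
    ae_all_iff.2 fun i => by
      rw [ae_iff]
      simpa using h.measure_hyperplane i _
  filter_upwards [hne] with y hy
  refine propext ⟨fun hyx => ?_, fun hyx => Cube.index_eq_of_mem_dyadic hyx hy⟩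
  have hyx : Q.index k y = Q.index k x := hyx
  exact Cube.dyadicAt_congr hyx ▸ Q.mem_dyadicAt k y

end IsDoubling

/-- Weak-type bound for the maximal function along a nested sequence of countable partitions. -/
lemma mul_measure_le_lintegral_of_nested {X ι : Type*} [MeasurableSpace X] [MeasurableSpace ι]
    [Countable ι] [MeasurableSingletonClass ι] {μ : Measure X} {p : ℕ → X → ι}
    (hp : ∀ m, Measurable (p m))
    (hnest : ∀ {k m x y}, k ≤ m → p m x = p m y → p k x = p k y)
    (g : X → ℝ≥0∞) (t : ℝ≥0∞) (k : ℕ) (z : ι) :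
    t * μ {y | p k y = z ∧ ∃ m, k ≤ m ∧
        t * μ (p m ⁻¹' {p m y}) ≤ ∫⁻ x in p m ⁻¹' {p m y}, g x ∂μ} ≤
      ∫⁻ x in p k ⁻¹' {z}, g x ∂μ := by
  classical
  let good : ℕ → ι → Prop := fun m w => t * μ (p m ⁻¹' {w}) ≤ ∫⁻ x in p m ⁻¹' {w}, g x ∂μ
  let T : Set (ℕ × ι) := {q | k ≤ q.1 ∧ good q.1 q.2 ∧
    ∃ y, p k y = z ∧ p q.1 y = q.2 ∧ ∀ j, k ≤ j → j < q.1 → ¬ good j (p j y)}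
  let cell : ℕ × ι → Set X := fun q => p q.1 ⁻¹' {q.2}
  have hT : T.Countable := T.to_countable
  have hcell : ∀ q ∈ T, MeasurableSet (cell q) := fun q _ => hp _ (measurableSet_singleton _)
  have hlt : ∀ q ∈ T, ∀ q' ∈ T, ∀ y, y ∈ cell q → y ∈ cell q' → ¬ q.1 < q'.1 := by
    rintro ⟨m, w⟩ ⟨hkm, hgood, -⟩ ⟨m', w'⟩ ⟨-, -, y', -, hy'w, hmin⟩ y (hy : p m y = w)
      (hy' : p m' y = w') hlt
    refine hmin m hkm hlt ?_
    rwa [hnest hlt.le (hy'w.trans hy'.symm), hy]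
  have hdisj : T.PairwiseDisjoint cell := by
    intro q hq q' hq' hne
    refine Set.disjoint_left.2 fun y hy hy' => hne ?_
    have h₁ : q.1 = q'.1 := le_antisymm (not_lt.1 (hlt q' hq' q hq y hy' hy))
      (not_lt.1 (hlt q hq q' hq' y hy hy'))
    refine Prod.ext h₁ ?_
    have hy : p q.1 y = q.2 := hy
    have hy' : p q'.1 y = q'.2 := hy'
    rw [← hy, ← hy', h₁]
  have hcover : {y | p k y = z ∧ ∃ m, k ≤ m ∧ good m (p m y)} ⊆ ⋃ q ∈ T, cell q := by
    rintro y ⟨hyz, hex⟩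
    have hspec := Nat.find_spec hex
    refine mem_biUnion (x := (Nat.find hex, p (Nat.find hex) y))
      ⟨hspec.1, hspec.2, y, hyz, rfl, fun j hkj hj hgood => ?_⟩ rfl
    exact Nat.find_min hex hj ⟨hkj, hgood⟩
  have hsub : ⋃ q ∈ T, cell q ⊆ p k ⁻¹' {z} := by
    refine iUnion₂_subset ?_
    rintro ⟨m, w⟩ ⟨hkm, -, y', hy'z, hy'w, -⟩ y (hy : p m y = w)
    exact (hnest hkm (hy.trans hy'w.symm)).trans hy'z
  calc
    t * μ {y | p k y = z ∧ ∃ m, k ≤ m ∧ good m (p m y)}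
      ≤ t * ∑' q : T, μ (cell q) :=
        mul_le_mul_right ((measure_mono hcover).trans (measure_biUnion_le μ hT cell)) t
    _ = ∑' q : T, t * μ (cell q) := ENNReal.tsum_mul_left.symm
    _ ≤ ∑' q : T, ∫⁻ x in cell q, g x ∂μ := ENNReal.tsum_le_tsum fun q => q.2.2.1
    _ = ∫⁻ x in ⋃ q ∈ T, cell q, g x ∂μ := (lintegral_biUnion hT hcell hdisj g).symm
    _ ≤ ∫⁻ x in p k ⁻¹' {z}, g x ∂μ := lintegral_mono_set hsub

section StoppingTime

variable {n : ℕ} (μ : Measure (Fin n → ℝ)) (f : (Fin n → ℝ) → ℝ) (Q : Cube n)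

/-- The mean over `P` of the deviation of `f` from its average over `R`. -/
def meanDev (R P : Cube n) : ℝ :=
  ⨍ y in P.carrier, |f y - cubeAvg μ R f| ∂μ

/-- The generation of the last stopping cube among the dyadic cubes containing `x` of
generation at most `k`. A cube stops when the mean deviation of `f` from its average over the
previous stopping cube exceeds twice the oscillation over that cube. -/
def stoppingGen (x : Fin n → ℝ) : ℕ → ℕ
  | 0 => 0
  | k + 1 =>
    open Classical in
    if 2 * osc μ (Q.dyadicAt (stoppingGen x k) x) f <
        meanDev μ f (Q.dyadicAt (stoppingGen x k) x) (Q.dyadicAt (k + 1) x) then k + 1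
    else stoppingGen x k

variable {Q}

lemma stoppingGen_le (x : Fin n → ℝ) (k : ℕ) : stoppingGen μ f Q x k ≤ k := by
  induction k with
  | zero => rfl
  | succ k ih =>
    rw [stoppingGen]
    split_ifs <;> omega

lemma stoppingGen_congr {x y : Fin n → ℝ} {k : ℕ} (h : Q.index k x = Q.index k y) :
    stoppingGen μ f Q x k = stoppingGen μ f Q y k := by
  induction k with
  | zero => rfl
  | succ k ih =>
    have h' := Cube.index_eq_of_index_succ_eq h
    rw [stoppingGen, stoppingGen, ← ih h', Cube.dyadicAt_congr h,
      Cube.dyadicAt_congr (Cube.index_eq_of_le (stoppingGen_le μ f x k) h')]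

lemma measurableSet_stoppingGen_eq (k l : ℕ) :
    MeasurableSet {y | stoppingGen μ f Q y k = l} := by
  have : {y | stoppingGen μ f Q y k = l} =
      Q.index k ⁻¹' (Q.index k '' {y | stoppingGen μ f Q y k = l}) := by
    refine Subset.antisymm (subset_preimage_image _ _) ?_
    rintro y ⟨x, hx, hxy⟩
    exact (stoppingGen_congr μ f hxy).symm.trans hx
  rw [this]
  exact Q.measurable_index k (Set.to_countable _).measurableSet

lemma exists_stopping_of_stoppingGen_ne {y : Fin n → ℝ} {k m : ℕ} (hkm : k ≤ m)
    (hk : stoppingGen μ f Q y k = k) (hm : stoppingGen μ f Q y m ≠ k) :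
    ∃ l, k ≤ l ∧ 2 * osc μ (Q.dyadicAt k y) f < meanDev μ f (Q.dyadicAt k y) (Q.dyadicAt l y) := by
  by_contra! hcon
  refine hm ?_
  induction m, hkm using Nat.le_induction with
  | base => exact hk
  | succ m hkm ih =>
    have ih : stoppingGen μ f Q y m = k := by
      by_contra hne
      exact hne (ih hne)
    rw [stoppingGen, ih, if_neg (not_lt.2 (hcon _ (by omega)))]

end StoppingTime

section Oscillation

variable {n : ℕ} {μ : Measure (Fin n → ℝ)} {c d : ℝ} {f : (Fin n → ℝ) → ℝ}

lemma osc_nonneg (μ : Measure (Fin n → ℝ)) (P : Cube n) (f : (Fin n → ℝ) → ℝ) :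
    0 ≤ osc μ P f := by
  rw [osc, setAverage_eq]
  exact smul_nonneg (by positivity) (integral_nonneg fun _ => abs_nonneg _)

namespace IsDoubling

lemma real_carrier_pos (h : IsDoubling μ c d) (P : Cube n) : 0 < μ.real P.carrier :=
  ENNReal.toReal_pos (h.2.2.1 P).1.ne' (h.2.2.1 P).2.ne

lemma integrableOn_carrier (hf : LocallyIntegrable f μ) (P : Cube n) :
    IntegrableOn f P.carrier μ :=
  hf.integrableOn_isCompact P.isCompact_carrier

lemma integrableOn_const_carrier (h : IsDoubling μ c d) (a : ℝ) (P : Cube n) :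
    IntegrableOn (fun _ => a) P.carrier μ :=
  integrableOn_const (h.2.2.1 P).2.ne

lemma integrableOn_abs_sub (h : IsDoubling μ c d) (hf : LocallyIntegrable f μ) (a : ℝ)
    (P : Cube n) : IntegrableOn (fun y => |f y - a|) P.carrier μ :=
  ((integrableOn_carrier hf P).sub (h.integrableOn_const_carrier a P)).abs

lemma setIntegral_abs_sub (h : IsDoubling μ c d) (R P : Cube n) :
    ∫ y in P.carrier, |f y - cubeAvg μ R f| ∂μ = meanDev μ f R P * μ.real P.carrier := by
  have := (h.real_carrier_pos P).ne'
  rw [meanDev, setAverage_eq, smul_eq_mul]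
  field_simp

lemma lintegral_abs_sub (h : IsDoubling μ c d) (hf : LocallyIntegrable f μ) (R P : Cube n) :
    ∫⁻ y in P.carrier, ENNReal.ofReal |f y - cubeAvg μ R f| ∂μ =
      ENNReal.ofReal (meanDev μ f R P) * μ P.carrier := by
  rw [← ofReal_integral_eq_lintegral_ofReal (h.integrableOn_abs_sub hf _ P)
    (ae_of_all _ fun _ => abs_nonneg _), h.setIntegral_abs_sub,
    ENNReal.ofReal_mul' measureReal_nonneg, measureReal_def,
    ENNReal.ofReal_toReal (h.2.2.1 P).2.ne]

lemma abs_cubeAvg_sub_le (h : IsDoubling μ c d) (hf : LocallyIntegrable f μ) (R P : Cube n) :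
    |cubeAvg μ P f - cubeAvg μ R f| ≤ meanDev μ f R P := by
  have hP := h.real_carrier_pos P
  refine le_of_mul_le_mul_right ?_ hP
  rw [← h.setIntegral_abs_sub]
  refine le_trans (le_of_eq ?_) (abs_integral_le_integral_abs (f := fun y => f y - cubeAvg μ R f))
  rw [integral_sub (integrableOn_carrier hf P) (h.integrableOn_const_carrier _ P),
    setIntegral_const, smul_eq_mul]
  nth_rewrite 1 [cubeAvg]
  rw [setAverage_eq, smul_eq_mul, ← abs_of_pos hP, ← abs_mul, abs_of_pos hP]
  congr 1
  field_simp

lemma meanDev_mul_le (h : IsDoubling μ c d) (hf : LocallyIntegrable f μ) (R : Cube n)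
    {P P' : Cube n} (hsub : P.carrier ⊆ P'.carrier) :
    meanDev μ f R P * μ.real P.carrier ≤ meanDev μ f R P' * μ.real P'.carrier := by
  rw [← h.setIntegral_abs_sub, ← h.setIntegral_abs_sub]
  exact setIntegral_mono_set (h.integrableOn_abs_sub hf _ P')
    (ae_of_all _ fun _ => abs_nonneg _) hsub.eventuallyLE

lemma meanDev_dyadicAt_succ_le (h : IsDoubling μ c d) (hf : LocallyIntegrable f μ)
    (R Q : Cube n) (k : ℕ) (x : Fin n → ℝ) :
    meanDev μ f R (Q.dyadicAt (k + 1) x) ≤ c * 2 ^ d * meanDev μ f R (Q.dyadicAt k x) := by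
  have hsub := Q.dyadicAt_succ_subset k x
  have hP := h.real_carrier_pos (Q.dyadicAt (k + 1) x)
  have hc : 0 < c := one_pos.trans_le h.1
  have hratio : (Q.dyadicAt k x).side / (Q.dyadicAt (k + 1) x).side = 2 := by
    have := Q.side_pos
    rw [Cube.dyadicAt_side, Cube.dyadicAt_side, pow_succ]
    field_simp
  have hμ : μ.real (Q.dyadicAt k x).carrier ≤
      c * 2 ^ d * μ.real (Q.dyadicAt (k + 1) x).carrier := by
    have := h.2.2.2 _ _ hsub
    rw [hratio] at this
    have := ENNReal.toReal_mono (ENNReal.mul_ne_top ENNReal.ofReal_ne_top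
      (h.2.2.1 (Q.dyadicAt (k + 1) x)).2.ne) this
    rwa [ENNReal.toReal_mul, ENNReal.toReal_ofReal (by positivity)] at this
  have hnonneg : 0 ≤ meanDev μ f R (Q.dyadicAt k x) :=
    (abs_nonneg _).trans (h.abs_cubeAvg_sub_le hf R _)
  refine le_of_mul_le_mul_right ?_ hP
  calc _ ≤ _ := h.meanDev_mul_le hf R hsub
    _ ≤ _ := mul_le_mul_of_nonneg_left hμ hnonneg
    _ = _ := by ring

lemma cubeAvg_chain (h : IsDoubling μ c d) (hf : LocallyIntegrable f μ) (Q : Cube n)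
    (x : Fin n → ℝ) (m : ℕ) :
    meanDev μ f (Q.dyadicAt (stoppingGen μ f Q x m) x) (Q.dyadicAt m x) ≤
        2 * osc μ (Q.dyadicAt (stoppingGen μ f Q x m) x) f ∧
      |cubeAvg μ (Q.dyadicAt (stoppingGen μ f Q x m) x) f - cubeAvg μ (Q.dyadicAt 0 x) f| +
          2 * (c * 2 ^ d) * osc μ (Q.dyadicAt (stoppingGen μ f Q x m) x) f ≤
        2 * (c * 2 ^ d) * ∑ k ∈ (Finset.range (m + 1)).filter fun k => stoppingGen μ f Q x k = k,
          osc μ (Q.dyadicAt k x) f := by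
  have hc : 0 < c := one_pos.trans_le h.1
  induction m with
  | zero =>
    have := osc_nonneg μ (Q.dyadicAt 0 x) f
    refine ⟨?_, ?_⟩
    · change osc μ (Q.dyadicAt 0 x) f ≤ 2 * osc μ (Q.dyadicAt 0 x) f
      linarith
    · simp [stoppingGen, Finset.sum_filter]
  | succ m ih =>
    obtain ⟨ih₁, ih₂⟩ := ih
    rw [Finset.range_add_one, Finset.filter_insert]
    set j := stoppingGen μ f Q x m with hj
    by_cases hdev : 2 * osc μ (Q.dyadicAt j x) f <
        meanDev μ f (Q.dyadicAt j x) (Q.dyadicAt (m + 1) x)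
    · have hm : stoppingGen μ f Q x (m + 1) = m + 1 := by
        rw [stoppingGen, ← hj, if_pos hdev]
      have hosc := osc_nonneg μ (Q.dyadicAt (m + 1) x) f
      rw [if_pos hm, hm, Finset.sum_insert (by simp)]
      refine ⟨?_, ?_⟩
      · change osc μ (Q.dyadicAt (m + 1) x) f ≤ 2 * osc μ (Q.dyadicAt (m + 1) x) f
        linarith
      · have h₁ := h.abs_cubeAvg_sub_le hf (Q.dyadicAt j x) (Q.dyadicAt (m + 1) x)
        have h₂ := h.meanDev_dyadicAt_succ_le hf (Q.dyadicAt j x) Q m x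
        have h₃ := mul_le_mul_of_nonneg_left ih₁ (a := c * 2 ^ d) (by positivity)
        have h₄ := abs_sub_le (cubeAvg μ (Q.dyadicAt (m + 1) x) f) (cubeAvg μ (Q.dyadicAt j x) f)
          (cubeAvg μ (Q.dyadicAt 0 x) f)
        linarith
    · have hm : stoppingGen μ f Q x (m + 1) = j := by
        rw [stoppingGen, ← hj, if_neg hdev]
      have hne : stoppingGen μ f Q x (m + 1) ≠ m + 1 := by
        have := stoppingGen_le μ f (Q := Q) x m
        omega
      rw [if_neg hne, hm]
      exact ⟨not_lt.1 hdev, ih₂⟩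

lemma abs_cubeAvg_sub_cubeAvg_le_sum (h : IsDoubling μ c d) (hf : LocallyIntegrable f μ)
    (Q : Cube n) (x : Fin n → ℝ) (m : ℕ) :
    |cubeAvg μ (Q.dyadicAt m x) f - cubeAvg μ (Q.dyadicAt 0 x) f| ≤
      2 * (c * 2 ^ d) * ∑ k ∈ (Finset.range (m + 1)).filter fun k => stoppingGen μ f Q x k = k,
        osc μ (Q.dyadicAt k x) f := by
  obtain ⟨h₁, h₂⟩ := h.cubeAvg_chain hf Q x m
  set R := Q.dyadicAt (stoppingGen μ f Q x m) x
  have h₃ := h.abs_cubeAvg_sub_le hf R (Q.dyadicAt m x)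
  have h₄ := abs_sub_le (cubeAvg μ (Q.dyadicAt m x) f) (cubeAvg μ R f)
    (cubeAvg μ (Q.dyadicAt 0 x) f)
  have hK : 1 ≤ c * 2 ^ d := one_le_mul_of_one_le_of_one_le h.1
    (Real.one_le_rpow one_le_two h.2.1.le)
  have h₅ := mul_le_mul_of_nonneg_right hK (osc_nonneg μ R f)
  linarith

/-- The set where a dyadic subcube stops below a given cube occupies at most half of it. -/
lemma two_mul_measure_stopping_le (h : IsDoubling μ c d) (hf : LocallyIntegrable f μ)
    (Q : Cube n) (k : ℕ) (x : Fin n → ℝ) :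
    2 * μ {y | Q.index k y = Q.index k x ∧ ∃ m, k ≤ m ∧
        2 * osc μ (Q.dyadicAt k x) f < meanDev μ f (Q.dyadicAt k x) (Q.dyadicAt m y)} ≤
      μ (Q.dyadicAt k x).carrier := by
  set P := Q.dyadicAt k x with hP
  rcases (osc_nonneg μ P f).eq_or_lt with hosc | hosc
  · have : {y | Q.index k y = Q.index k x ∧ ∃ m, k ≤ m ∧
        2 * osc μ P f < meanDev μ f P (Q.dyadicAt m y)} = ∅ := by
      refine eq_empty_of_forall_notMem ?_
      rintro y ⟨hyx, m, hkm, hlt⟩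
      have hsub : (Q.dyadicAt m y).carrier ⊆ P.carrier := by
        rw [hP, ← Cube.dyadicAt_congr hyx]
        exact Q.dyadicAt_subset hkm y
      have h₁ := h.meanDev_mul_le hf P hsub
      have h₂ : meanDev μ f P P = 0 := hosc.symm
      rw [← hosc, mul_zero] at hlt
      rw [h₂, zero_mul] at h₁
      exact (mul_pos hlt (h.real_carrier_pos _)).not_ge h₁
    rw [this]
    simp
  · have key := mul_measure_le_lintegral_of_nested (μ := μ) Q.measurable_index
      Cube.index_eq_of_le (fun y => ENNReal.ofReal |f y - cubeAvg μ P f|)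
      (ENNReal.ofReal (2 * osc μ P f)) k (Q.index k x)
    rw [setLIntegral_congr (h.index_preimage_ae_eq Q k x), h.lintegral_abs_sub hf] at key
    change _ ≤ ENNReal.ofReal (osc μ P f) * μ P.carrier at key
    rw [ENNReal.ofReal_mul two_pos.le, mul_comm (ENNReal.ofReal 2), mul_assoc,
      ENNReal.mul_le_mul_iff_right (by simpa using hosc) ENNReal.ofReal_ne_top,
      ENNReal.ofReal_ofNat] at key
    refine le_trans ?_ key
    gcongr 2 * μ ?_
    rintro y ⟨hyx, m, hkm, hlt⟩
    refine ⟨hyx, m, hkm, ?_⟩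
    rw [setLIntegral_congr (h.index_preimage_ae_eq Q m y), h.lintegral_abs_sub hf,
      measure_congr (h.index_preimage_ae_eq Q m y), mul_comm (ENNReal.ofReal (osc μ P f)),
      ← ENNReal.ofReal_ofNat, ← ENNReal.ofReal_mul two_pos.le]
    gcongr

/-- The part of a stopping cube that is not covered by later stopping cubes occupies at least
half of it. -/
lemma measure_le_two_mul_measure_nonstopping (h : IsDoubling μ c d) (hf : LocallyIntegrable f μ)
    (Q : Cube n) {k : ℕ} {x : Fin n → ℝ} (hx : stoppingGen μ f Q x k = k) :
    μ (Q.dyadicAt k x).carrier ≤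
      2 * μ {y | Q.index k y = Q.index k x ∧ ∀ m, k ≤ m → stoppingGen μ f Q y m = k} := by
  set P := Q.dyadicAt k x
  set E := {y | Q.index k y = Q.index k x ∧ ∀ m, k ≤ m → stoppingGen μ f Q y m = k}
  have hB := h.two_mul_measure_stopping_le hf Q k x
  set B := {y | Q.index k y = Q.index k x ∧ ∃ m, k ≤ m ∧
    2 * osc μ P f < meanDev μ f P (Q.dyadicAt m y)}
  have hcover : Q.index k ⁻¹' {Q.index k x} ⊆ E ∪ B := by
    intro y (hyx : Q.index k y = Q.index k x)
    by_cases hy : ∀ m, k ≤ m → stoppingGen μ f Q y m = k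
    · exact Or.inl ⟨hyx, hy⟩
    · push Not at hy
      obtain ⟨m, hkm, hm⟩ := hy
      have hk := (stoppingGen_congr μ f hyx).trans hx
      have := exists_stopping_of_stoppingGen_ne μ f hkm hk hm
      rw [Cube.dyadicAt_congr hyx] at this
      exact Or.inr ⟨hyx, this⟩
  have h₁ : μ P.carrier ≤ μ E + μ B := by
    rw [← measure_congr (h.index_preimage_ae_eq Q k x)]
    exact (measure_mono hcover).trans (measure_union_le E B)
  refine (ENNReal.add_le_add_iff_right (h.2.2.1 P).2.ne).1 ?_
  calc μ P.carrier + μ P.carrier = 2 * μ P.carrier := (two_mul _).symm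
    _ ≤ 2 * (μ E + μ B) := by gcongr
    _ = 2 * μ E + 2 * μ B := mul_add _ _ _
    _ ≤ 2 * μ E + μ P.carrier := by gcongr

lemma ae_tendsto_cubeAvg (h : IsDoubling μ c d) (hf : LocallyIntegrable f μ) (Q : Cube n) :
    ∀ᵐ x ∂μ, Tendsto (fun m => cubeAvg μ (Q.dyadicAt m x) f) atTop (nhds (f x)) := by
  have := h.isLocallyFiniteMeasure
  have := h.isUnifLocDoublingMeasure
  filter_upwards [IsUnifLocDoublingMeasure.ae_tendsto_average μ hf 1] with x hx
  simp only [cubeAvg, Cube.carrier_eq_closedBall]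
  refine hx _ _ (tendsto_nhdsWithin_iff.2 ⟨?_, .of_forall fun m => ?_⟩) (.of_forall fun m => ?_)
  · have : Tendsto (fun m : ℕ => Q.side / 2 * (1 / 2 : ℝ) ^ m) atTop (nhds (Q.side / 2 * 0)) :=
      (tendsto_pow_atTop_nhds_zero_of_lt_one (by norm_num) (by norm_num)).const_mul _
    rw [mul_zero] at this
    refine this.congr fun m => ?_
    rw [Cube.dyadicAt_side, one_div, inv_pow]
    ring
  · exact half_pos (Q.dyadicAt m x).side_pos
  · rw [one_mul, ← Cube.carrier_eq_closedBall]
    exact Q.mem_dyadicAt m x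

end IsDoubling

end Oscillation

/-- The stopping cubes of `f` inside `Q`. -/
def stoppingCubes {n : ℕ} (μ : Measure (Fin n → ℝ)) (f : (Fin n → ℝ) → ℝ) (Q : Cube n) :
    Set (Cube n) :=
  {P | ∃ k x, Q.index 0 x = 0 ∧ stoppingGen μ f Q x k = k ∧ P = Q.dyadicAt k x}

/-- The points whose smallest stopping cube is `P`. -/
def nonstoppingSet {n : ℕ} (μ : Measure (Fin n → ℝ)) (f : (Fin n → ℝ) → ℝ) (Q P : Cube n) :
    Set (Fin n → ℝ) :=
  {y | ∃ k, P = Q.dyadicAt k y ∧ ∀ m, k ≤ m → stoppingGen μ f Q y m = k}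

section Stopping

variable {n : ℕ} (μ : Measure (Fin n → ℝ)) (f : (Fin n → ℝ) → ℝ) (Q : Cube n)

lemma countable_stoppingCubes : (stoppingCubes μ f Q).Countable := by
  refine (countable_range fun q : ℕ × (Fin n → ℤ) => Q.dyadic q.1 q.2).mono ?_
  rintro P ⟨k, x, -, -, rfl⟩
  exact ⟨(k, Q.index k x), rfl⟩

lemma nonstoppingSet_dyadicAt (k : ℕ) (x : Fin n → ℝ) :
    nonstoppingSet μ f Q (Q.dyadicAt k x) =
      {y | Q.index k y = Q.index k x ∧ ∀ m, k ≤ m → stoppingGen μ f Q y m = k} := by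
  ext y
  constructor
  · rintro ⟨l, hl, hy⟩
    obtain rfl := Cube.generation_eq_of_dyadic_eq hl
    exact ⟨(Cube.index_eq_of_dyadicAt_eq hl).symm, hy⟩
  · rintro ⟨hyx, hy⟩
    exact ⟨k, (Cube.dyadicAt_congr hyx).symm, hy⟩

lemma measurableSet_nonstoppingSet_dyadicAt (k : ℕ) (x : Fin n → ℝ) :
    MeasurableSet (nonstoppingSet μ f Q (Q.dyadicAt k x)) := by
  rw [nonstoppingSet_dyadicAt]
  have : {y | Q.index k y = Q.index k x ∧ ∀ m, k ≤ m → stoppingGen μ f Q y m = k} =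
      Q.index k ⁻¹' {Q.index k x} ∩ ⋂ m, ⋂ (_ : k ≤ m), {y | stoppingGen μ f Q y m = k} := by
    ext y
    simp
  rw [this]
  exact (Q.measurable_index k (measurableSet_singleton _)).inter <|
    MeasurableSet.iInter fun m => MeasurableSet.iInter fun _ => measurableSet_stoppingGen_eq μ f m k

lemma nonstoppingSet_subset (P : Cube n) : nonstoppingSet μ f Q P ⊆ P.carrier := by
  rintro y ⟨k, rfl, -⟩
  exact Q.mem_dyadicAt k y

lemma disjoint_nonstoppingSet {P P' : Cube n} (hne : P ≠ P') :
    Disjoint (nonstoppingSet μ f Q P) (nonstoppingSet μ f Q P') := by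
  refine Set.disjoint_left.2 ?_
  rintro y ⟨k, rfl, hk⟩ ⟨l, rfl, hl⟩
  have hkl : k = l := (hk (max k l) (le_max_left k l)).symm.trans (hl _ (le_max_right k l))
  exact hne (hkl ▸ rfl)

variable {Q}

lemma sum_osc_le_tsum {x : Fin n → ℝ} (hx : Q.index 0 x = 0) (m : ℕ) :
    ENNReal.ofReal (∑ k ∈ (Finset.range m).filter fun k => stoppingGen μ f Q x k = k,
        osc μ (Q.dyadicAt k x) f) ≤
      ∑' P : stoppingCubes μ f Q, ENNReal.ofReal (osc μ (P : Cube n) f) *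
        Set.indicator (P : Cube n).carrier (fun _ => (1 : ℝ≥0∞)) x := by
  rw [ENNReal.ofReal_sum_of_nonneg fun k _ => osc_nonneg μ _ f, ← Finset.sum_coe_sort]
  let e : {k // k ∈ (Finset.range m).filter fun k => stoppingGen μ f Q x k = k} →
      stoppingCubes μ f Q :=
    fun k => ⟨Q.dyadicAt k x, k, x, hx, (Finset.mem_filter.1 k.2).2, rfl⟩
  have he : Function.Injective e := fun k l hkl =>
    Subtype.ext (Cube.generation_eq_of_dyadic_eq (congrArg Subtype.val hkl))
  rw [← tsum_fintype (L := SummationFilter.unconditional _)]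
  refine le_trans (le_of_eq ?_) (ENNReal.tsum_comp_le_tsum_of_injective he _)
  refine tsum_congr fun k => ?_
  simp only [e]
  rw [indicator_of_mem (Q.mem_dyadicAt k x), mul_one]

end Stopping

/-- Lemma A.1 (local sparse domination of oscillations): for a doubling measure `μ`,
`f ∈ L¹_loc(dμ)` and a cube `Q₀`, there are a countable family `𝒮` of subcubes of `Q₀`
and pairwise disjoint sets `E_Q ⊆ Q` with `μ(Q) ≤ 2 μ(E_Q)` such that, for `μ`-a.e.
`x ∈ Q₀`,
`|f(x) − f_{Q₀,μ}| ≤ C Σ_{Q ∈ 𝒮} ((1/μ(Q)) ∫_Q |f − f_{Q,μ}| dμ) χ_Q(x)`,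
where `C > 0` depends only on `c_μ` and `n_μ`. -/
theorem statement19 (n : ℕ) (c d : ℝ) (hc : 1 ≤ c) (hd : 0 < d) :
    ∃ C : ℝ, 0 < C ∧
      ∀ μ : Measure (Fin n → ℝ), IsDoubling μ c d →
      ∀ f : (Fin n → ℝ) → ℝ, LocallyIntegrable f μ → ∀ Q₀ : Cube n,
      ∃ 𝒮 : Set (Cube n), 𝒮.Countable ∧ (∀ Q ∈ 𝒮, Q.carrier ⊆ Q₀.carrier) ∧
        ∃ E : Cube n → Set (Fin n → ℝ),
          (∀ Q ∈ 𝒮, MeasurableSet (E Q) ∧ E Q ⊆ Q.carrier ∧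
            μ Q.carrier ≤ 2 * μ (E Q)) ∧
          (𝒮.Pairwise fun Q Q' => Disjoint (E Q) (E Q')) ∧
          ∀ᵐ x ∂μ.restrict Q₀.carrier,
            ENNReal.ofReal |f x - cubeAvg μ Q₀ f| ≤
              ENNReal.ofReal C *
                ∑' Q : 𝒮, ENNReal.ofReal (osc μ (Q : Cube n) f) *
                  Set.indicator (Q : Cube n).carrier (fun _ => (1 : ℝ≥0∞)) x := by
  have hK : 0 < 2 * (c * 2 ^ d) := by positivity
  refine ⟨2 * (c * 2 ^ d), hK, fun μ h f hf Q₀ => ⟨stoppingCubes μ f Q₀,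
    countable_stoppingCubes μ f Q₀, ?_, nonstoppingSet μ f Q₀, ?_,
    fun P _ P' _ hne => disjoint_nonstoppingSet μ f Q₀ hne, ?_⟩⟩
  · rintro P ⟨k, x, hx, -, rfl⟩
    exact (Q₀.dyadicAt_subset (Nat.zero_le k) x).trans_eq (by rw [Cube.dyadicAt_zero hx])
  · rintro P ⟨k, x, -, hdev, rfl⟩
    refine ⟨measurableSet_nonstoppingSet_dyadicAt μ f Q₀ k x, nonstoppingSet_subset μ f Q₀ _, ?_⟩
    rw [nonstoppingSet_dyadicAt]
    exact h.measure_le_two_mul_measure_nonstopping hf Q₀ hdev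
  · have hindex : ∀ᵐ x ∂μ.restrict Q₀.carrier, Q₀.index 0 x = 0 := by
      have hcorner : Q₀.index 0 Q₀.corner = 0 := by
        funext i
        simp [Cube.index]
      have := h.index_preimage_ae_eq Q₀ 0 Q₀.corner
      rw [Cube.dyadicAt_zero hcorner, hcorner] at this
      rw [ae_restrict_iff' Q₀.measurableSet_carrier_s19]
      filter_upwards [this] with x hx hxQ
      exact (iff_of_eq hx).2 hxQ
    filter_upwards [hindex, ae_restrict_of_ae (h.ae_tendsto_cubeAvg hf Q₀)] with x hx hlim
    refine le_of_tendsto' (ENNReal.tendsto_ofReal (hlim.sub_const (cubeAvg μ Q₀ f)).abs)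
      fun m => ?_
    have hm := h.abs_cubeAvg_sub_cubeAvg_le_sum hf Q₀ x m
    rw [Cube.dyadicAt_zero hx] at hm
    refine (ENNReal.ofReal_le_ofReal hm).trans ?_
    rw [ENNReal.ofReal_mul hK.le]
    gcongr
    exact sum_osc_le_tsum μ f hx (m + 1)

end
end
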